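/- arXiv:math/0609246 — 7 statements merged into one kernel-verified Lean document; each statement's English description precedes it below -/
import Mathlib

section
/- The inverse function f of h satisfies lim_{v → +∞} f(v)/√(2v) = 1. -/
/-- The function `h(u) = (1/2)·u·√(1+u²) + (1/2)·log(u + √(1+u²))`. -/
noncomputable def h (u : ℝ) : ℝ :=
  (1/2) * u * Real.sqrt (1 + u^2) + (1/2) * Real.log (u + Real.sqrt (1 + u^2))

/-- If `f` is the inverse function of `h`, then `lim_{v → +∞} f(v)/√(2v) = 1`. -/
theorem stmt_3 (f : ℝ → ℝ) (hf₁ : Function.LeftInverse f h)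
    (hf₂ : Function.RightInverse f h) :
    Filter.Tendsto (fun v : ℝ => f v / Real.sqrt (2 * v)) Filter.atTop (nhds 1) := by
  have key : ∀ v : ℝ, 0 < v → Real.sqrt (2 * v) - 3 ≤ f v ∧ f v ≤ Real.sqrt (2 * v) := by
    intro v hv
    have e : h (f v) = v := hf₂ v
    generalize f v = u at e
    unfold h at e
    have hs0 : 0 ≤ Real.sqrt (1 + u^2) := Real.sqrt_nonneg _
    have hs : Real.sqrt (1 + u^2) ^ 2 = 1 + u^2 := Real.sq_sqrt (by positivity)
    generalize Real.sqrt (1 + u^2) = s at *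
    have hw0 : 0 ≤ Real.sqrt (2 * v) := Real.sqrt_nonneg _
    have hw : Real.sqrt (2 * v) ^ 2 = 2 * v := Real.sq_sqrt (by positivity)
    generalize Real.sqrt (2 * v) = w at *
    have hu : 0 ≤ u := by
      by_contra hu
      push Not at hu
      have h1 : s ≤ 1 - u := abs_le_of_sq_le_sq' (by nlinarith) (by linarith) |>.2
      have h2 : -u ≤ s := abs_le_of_sq_le_sq' (by nlinarith) hs0 |>.2
      have h3 := Real.log_nonpos (x := u + s) (by linarith) (by linarith)
      nlinarith [mul_nonneg hs0 (neg_nonneg.2 hu.le)]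
    have h1 : s ≤ 1 + u := abs_le_of_sq_le_sq' (by nlinarith) (by linarith) |>.2
    have h2 : u ≤ s := abs_le_of_sq_le_sq' (by nlinarith) hs0 |>.2
    have h3 : 1 ≤ s := abs_le_of_sq_le_sq' (by nlinarith) hs0 |>.2
    have h4 := Real.log_nonneg (x := u + s) (by linarith)
    have h5 := Real.log_le_sub_one_of_pos (x := u + s) (by linarith)
    constructor
    · have : w ≤ u + 3 := abs_le_of_sq_le_sq' (by nlinarith) (by linarith) |>.2
      linarith
    · exact abs_le_of_sq_le_sq' (by nlinarith) hw0 |>.2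
  have hT : Filter.Tendsto (fun v : ℝ => Real.sqrt (2 * v)) Filter.atTop Filter.atTop :=
    Real.tendsto_sqrt_atTop.comp (Filter.tendsto_id.const_mul_atTop (by norm_num))
  have hL : Filter.Tendsto (fun v : ℝ => 1 - 3 / Real.sqrt (2 * v)) Filter.atTop (nhds 1) := by
    simpa using (hT.const_div_atTop 3).const_sub 1
  refine tendsto_of_tendsto_of_tendsto_of_le_of_le' hL tendsto_const_nhds ?_ ?_
  · filter_upwards [Filter.eventually_gt_atTop 0] with v hv
    have hp : 0 < Real.sqrt (2 * v) := Real.sqrt_pos.2 (by linarith)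
    rw [le_div_iff₀ hp, sub_mul, div_mul_cancel₀ _ hp.ne']
    linarith [(key v hv).1]
  · filter_upwards [Filter.eventually_gt_atTop 0] with v hv
    have hp : 0 < Real.sqrt (2 * v) := Real.sqrt_pos.2 (by linarith)
    rw [div_le_one hp]
    exact (key v hv).2
end

section
/- Let G : ℝ → ℝ be defined by G(v) = f(v)². Then G is twice differentiable on ℝ with G'(v) = 2 f(v)/√(1 + f(v)²) and G''(v) = 2/(1 + f(v)²)² > 0 for all v ∈ ℝ; in particular G is (strictly) convex on ℝ and |G'(v)| ≤ 2 for every v ∈ ℝ. -/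
theorem h_hasDerivAt (u : ℝ) : HasDerivAt h (Real.sqrt (1 + u^2)) u := by
  have hp : (0:ℝ) < 1 + u^2 := by positivity
  have hs : 0 < Real.sqrt (1 + u^2) := Real.sqrt_pos.2 hp
  have hq : Real.sqrt (1 + u^2) ^ 2 = 1 + u^2 := Real.sq_sqrt hp.le
  have h1 : HasDerivAt (fun u : ℝ => 1 + u^2) (2 * u) u := by
    simpa using (hasDerivAt_pow 2 u).const_add 1
  have h2 := h1.sqrt hp.ne'
  have h3 := (((hasDerivAt_id u).const_mul (1/2 : ℝ)).mul h2).add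
    ((Real.hasDerivAt_arsinh u).const_mul (1/2 : ℝ))
  refine HasDerivAt.congr_deriv (f := h) h3 ?_
  simp only [id]
  field_simp
  nlinarith

/-- With `f` the inverse of `h` and `G(v) = f(v)²`: `G` is twice differentiable with
`G'(v) = 2 f(v)/√(1 + f(v)²)`, `G''(v) = 2/(1 + f(v)²)² > 0`; `G` is strictly convex
and `|G'(v)| ≤ 2`. -/
theorem stmt_4 (f : ℝ → ℝ) (hf₁ : Function.LeftInverse f h)
    (hf₂ : Function.RightInverse f h) (G : ℝ → ℝ) (hG : ∀ v : ℝ, G v = f v ^ 2) :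
    (∀ v : ℝ, HasDerivAt G (2 * f v / Real.sqrt (1 + f v ^ 2)) v) ∧
    (∀ v : ℝ, HasDerivAt (fun v : ℝ => 2 * f v / Real.sqrt (1 + f v ^ 2))
      (2 / (1 + f v ^ 2) ^ 2) v) ∧
    (∀ v : ℝ, 0 < 2 / (1 + f v ^ 2) ^ 2) ∧
    StrictConvexOn ℝ Set.univ G ∧
    (∀ v : ℝ, |2 * f v / Real.sqrt (1 + f v ^ 2)| ≤ 2) := by
  have hmono : StrictMono h := strictMono_of_hasDerivAt_pos h_hasDerivAt
    (fun u => Real.sqrt_pos.2 (by positivity))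
  have hcont : Continuous f := (hmono.orderIsoOfRightInverse h f hf₂).symm.continuous
  have hfd : ∀ v, HasDerivAt f (Real.sqrt (1 + f v ^ 2))⁻¹ v := fun v =>
    HasDerivAt.of_local_left_inverse hcont.continuousAt (h_hasDerivAt (f v))
      (Real.sqrt_pos.2 (by positivity)).ne' (Filter.Eventually.of_forall hf₂)
  have hG' : G = fun v => f v ^ 2 := funext hG
  have A : ∀ v : ℝ, HasDerivAt G (2 * f v / Real.sqrt (1 + f v ^ 2)) v := by
    intro v
    rw [hG']
    refine ((hfd v).pow 2).congr_deriv ?_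
    simp [div_eq_mul_inv]
  have B : ∀ v : ℝ, HasDerivAt (fun v : ℝ => 2 * f v / Real.sqrt (1 + f v ^ 2))
      (2 / (1 + f v ^ 2) ^ 2) v := by
    intro v
    have hp : (0:ℝ) < 1 + f v ^ 2 := by positivity
    have hs : 0 < Real.sqrt (1 + f v ^ 2) := Real.sqrt_pos.2 hp
    have hq : Real.sqrt (1 + f v ^ 2) ^ 2 = 1 + f v ^ 2 := Real.sq_sqrt hp.le
    have h1 : HasDerivAt (fun v : ℝ => 1 + f v ^ 2)
        (2 * f v * (Real.sqrt (1 + f v ^ 2))⁻¹) v := by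
      simpa using ((hfd v).pow 2).const_add 1
    refine (((hfd v).const_mul 2).div (h1.sqrt hp.ne') hs.ne').congr_deriv ?_
    have hf2 : f v ^ 2 = Real.sqrt (1 + f v ^ 2) ^ 2 - 1 := by linarith
    rw [← hq]
    rw [Real.sqrt_sq hs.le]
    generalize Real.sqrt (1 + f v ^ 2) = s at *
    field_simp
    rw [hf2]
    ring
  have C : ∀ v : ℝ, 0 < 2 / (1 + f v ^ 2) ^ 2 := fun v => by positivity
  refine ⟨A, B, C, ?_, ?_⟩
  · apply StrictMono.strictConvexOn_univ_of_deriv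
    · exact continuous_iff_continuousAt.2 fun v => (A v).continuousAt
    · rw [show deriv G = _ from funext fun v => (A v).deriv]
      exact strictMono_of_hasDerivAt_pos B C
  · intro v
    have hp : (0:ℝ) < 1 + f v ^ 2 := by positivity
    have hs : 0 < Real.sqrt (1 + f v ^ 2) := Real.sqrt_pos.2 hp
    rw [abs_div, abs_of_pos hs, div_le_iff₀ hs, abs_mul, abs_two]
    have : |f v| ≤ Real.sqrt (1 + f v ^ 2) := Real.abs_le_sqrt (by linarith)
    linarith
end

section
/- For every v ∈ ℝ one has f(v)² ≤ v² and f(v)² ≤ 2|v|; that is, G(v) = f(v)² ≤ min(v², 2|v|). -/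
lemma aux_mono : Monotone (fun t : ℝ => (Real.sinh t * Real.cosh t + t) / 2 - Real.sinh t) := by
  have hd : ∀ t : ℝ, HasDerivAt (fun t : ℝ => (Real.sinh t * Real.cosh t + t) / 2 - Real.sinh t)
      ((Real.cosh t * Real.cosh t + Real.sinh t * Real.sinh t + 1) / 2 - Real.cosh t) t := fun t =>
    ((((Real.hasDerivAt_sinh t).mul (Real.hasDerivAt_cosh t)).add (hasDerivAt_id t)).div_const 2).sub
      (Real.hasDerivAt_sinh t)
  refine monotone_of_deriv_nonneg (fun t => (hd t).differentiableAt) fun t => ?_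
  rw [(hd t).deriv]
  nlinarith [Real.one_le_cosh t, Real.cosh_sq t]

/-- With `f` the inverse of `h`: `f(v)² ≤ v²` and `f(v)² ≤ 2|v|` for every `v`. -/
theorem stmt_5 (f : ℝ → ℝ) (hf₁ : Function.LeftInverse f h)
    (hf₂ : Function.RightInverse f h) :
    ∀ v : ℝ, f v ^ 2 ≤ v ^ 2 ∧ f v ^ 2 ≤ 2 * |v| := by
  intro v
  obtain ⟨t, ht⟩ : ∃ t, Real.sinh t = f v := ⟨_, Real.sinh_arsinh _⟩
  have hv : v = (Real.sinh t * Real.cosh t + t) / 2 := by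
    have h1 := hf₂ v
    have h2 : Real.log (f v + Real.sqrt (1 + f v ^ 2)) = t := by
      change Real.arsinh (f v) = t
      rw [← ht, Real.arsinh_sinh]
    have h3 : Real.sqrt (1 + f v ^ 2) = Real.cosh t := by
      rw [← ht, ← Real.cosh_sq', Real.sqrt_sq (Real.cosh_pos t).le]
    unfold h at h1
    rw [h2, h3, ← ht] at h1
    linarith
  rw [← ht]
  have hs : Real.sinh t < Real.cosh t := Real.sinh_lt_cosh t
  have hc := Real.one_le_cosh t
  rcases le_total 0 t with h0 | h0
  · have hm := aux_mono h0
    have h4 : 0 ≤ Real.sinh t := Real.sinh_nonneg_iff.2 h0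
    simp only [Real.sinh_zero, Real.cosh_zero] at hm
    have h5 : Real.sinh t ≤ v := by linarith
    rw [abs_of_nonneg (h4.trans h5)]
    exact ⟨by nlinarith, by nlinarith⟩
  · have hm := aux_mono h0
    have h4 : Real.sinh t ≤ 0 := Real.sinh_nonpos_iff.2 h0
    simp only [Real.sinh_zero, Real.cosh_zero] at hm
    have h5 : v ≤ Real.sinh t := by linarith
    have h6 : -Real.sinh t < Real.cosh t := by
      have := Real.sinh_lt_cosh (-t)
      rwa [Real.sinh_neg, Real.cosh_neg] at this
    rw [abs_of_nonpos (h5.trans h4)]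
    exact ⟨by nlinarith, by nlinarith⟩
end

section
/- There exists a constant C₀ > 0 (for instance C₀ = 4) such that G(2v) ≤ C₀ · G(v) for every v ∈ ℝ, where G(v) = f(v)². -/
theorem h_eq_aux (x : ℝ) : h x = (1/2) * x * Real.sqrt (1 + x^2) + (1/2) * Real.arsinh x := rfl

theorem h_neg_aux (x : ℝ) : h (-x) = - h x := by
  rw [h_eq_aux, h_eq_aux, Real.arsinh_neg, neg_sq]; ring

theorem h_abs_aux (x : ℝ) : |h x| = |h (abs x)| := by
  rcases abs_choice x with hx | hx <;> rw [hx]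
  rw [h_neg_aux, abs_neg]

theorem h_bd_aux (x : ℝ) :
    (1/2) * |x| * Real.sqrt (1 + x^2) ≤ |h x| ∧ |h x| ≤ |x| * Real.sqrt (1 + x^2) := by
  have h0 := abs_nonneg x
  have h1 : 0 ≤ Real.arsinh |x| := Real.arsinh_nonneg_iff.2 h0
  have h2 : Real.arsinh |x| ≤ |x| := by
    have := Real.self_le_sinh_iff.2 h1
    rwa [Real.sinh_arsinh] at this
  have h3 : 1 ≤ Real.sqrt (1 + x^2) := Real.one_le_sqrt.2 (by nlinarith [sq_nonneg x])
  have h4 : 0 ≤ |x| * Real.sqrt (1 + x^2) := by positivity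
  have h5 : |h x| = (1/2) * |x| * Real.sqrt (1 + x^2) + (1/2) * Real.arsinh |x| := by
    rw [h_abs_aux, h_eq_aux, sq_abs, abs_of_nonneg (by nlinarith)]
  rw [h5]
  constructor <;> nlinarith

/-- With `f` the inverse of `h` and `G(v) = f(v)²`: there is `C₀ > 0` (e.g. `C₀ = 4`)
with `G(2v) ≤ C₀ G(v)` for all `v`. -/
theorem stmt_6 (f : ℝ → ℝ) (hf₁ : Function.LeftInverse f h)
    (hf₂ : Function.RightInverse f h) (G : ℝ → ℝ) (hG : ∀ v : ℝ, G v = f v ^ 2) :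
    ∃ C₀ : ℝ, 0 < C₀ ∧ ∀ v : ℝ, G (2 * v) ≤ C₀ * G v := by
  refine ⟨16, by norm_num, fun v => ?_⟩
  rw [hG, hG]
  have key : |h (f (2 * v))| = 2 * |h (f v)| := by
    rw [hf₂, hf₂, abs_mul, abs_two]
  have b1 := (h_bd_aux (f (2 * v))).1
  have b2 := (h_bd_aux (f v)).2
  by_contra hc
  push Not at hc
  have e : |4 * f v| < |f (2 * v)| := sq_lt_sq.1 (by nlinarith)
  rw [abs_mul, abs_of_pos (by norm_num : (0:ℝ) < 4)] at e
  have hs : Real.sqrt (1 + f v ^ 2) ≤ Real.sqrt (1 + f (2 * v) ^ 2) :=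
    Real.sqrt_le_sqrt (by nlinarith [sq_nonneg (f v)])
  have hp : 0 < Real.sqrt (1 + f (2 * v) ^ 2) := Real.sqrt_pos.2 (by positivity)
  have c1 := mul_lt_mul_of_pos_right e hp
  have c2 := mul_le_mul_of_nonneg_left hs (abs_nonneg (f v))
  nlinarith
end

section
/- Let N > 2, 2* = 2N/(N−2), q = 2·2*, 4 < θ < q, k > θ/(θ−2), α > 0, β = (α/k)^{1/(2(2*−1))}. Let Λ ⊂ ℝᴺ, let V : ℝᴺ → ℝ satisfy V ≥ 0 on ℝᴺ and V(x) ≥ α for x ∉ Λ, and define w(x,s) = χ_Λ(x)·γ(s) + (1−χ_Λ(x))·γ̄(s) and W(x,t) = ∫₀ᵗ w(x,s) ds, where γ(s) = s^{q−1} for s > 0, γ(s) = 0 for s ≤ 0, γ̄(s) = γ(s) for s ≤ β, γ̄(s) = (α/k)s for s > β. Then for every x ∈ ℝᴺ and every t ∈ ℝ, (1/θ)·w(x,t)·t − W(x,t) ≥ (1/k)·(1/θ − 1/2)·V(x)·t². -/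
open scoped Classical

/-- Superquadraticity estimate for the truncated nonlinearity: with
`w(x,s) = χ_Λ(x)γ(s) + (1−χ_Λ(x))γ̄(s)` and `W(x,t) = ∫₀ᵗ w(x,s) ds`, where `V ≥ 0`
and `V ≥ α` off `Λ`, `4 < θ < 2·2*`, `k > θ/(θ−2)`:
`(1/θ)·w(x,t)·t − W(x,t) ≥ (1/k)·(1/θ − 1/2)·V(x)·t²` for all `x` and `t`. -/
theorem stmt_11 (N : ℕ) (hN : 2 < N) (twoStar q : ℝ)
    (h2s : twoStar = 2 * N / (N - 2)) (hq : q = 2 * twoStar)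
    (θ k α β : ℝ) (hθ₁ : 4 < θ) (hθ₂ : θ < q) (hk : θ / (θ - 2) < k) (hα : 0 < α)
    (hβ : β = (α / k) ^ (1 / (2 * (twoStar - 1))))
    (Λ : Set (EuclideanSpace ℝ (Fin N)))
    (V : EuclideanSpace ℝ (Fin N) → ℝ) (hV₀ : ∀ x, 0 ≤ V x)
    (hVα : ∀ x, x ∉ Λ → α ≤ V x)
    (γ : ℝ → ℝ) (hγ : ∀ s : ℝ, γ s = if 0 < s then s ^ (q - 1) else 0)
    (γbar : ℝ → ℝ) (hγbar : ∀ s : ℝ, γbar s = if s ≤ β then γ s else (α / k) * s)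
    (w : EuclideanSpace ℝ (Fin N) → ℝ → ℝ)
    (hw : ∀ x s, w x s = if x ∈ Λ then γ s else γbar s)
    (W : EuclideanSpace ℝ (Fin N) → ℝ → ℝ)
    (hW : ∀ x t, W x t = ∫ s in (0 : ℝ)..t, w x s) :
    ∀ (x : EuclideanSpace ℝ (Fin N)) (t : ℝ),
      (1 / θ) * w x t * t - W x t ≥ (1 / k) * (1 / θ - 1 / 2) * V x * t ^ 2 := by
  have hq4 : 4 < q := by linarith
  have hθ2 : 0 < θ - 2 := by linarith
  have hk0 : 0 < k := lt_trans (div_pos (by linarith) hθ2) hk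
  have hak : 0 < α / k := div_pos hα hk0
  have hβ0 : 0 < β := by rw [hβ]; exact Real.rpow_pos_of_pos hak _
  have hβq : β ^ q = α / k * β ^ 2 := by
    have h1 : β ^ (q - 2) = α / k := by
      rw [hβ, ← Real.rpow_mul hak.le, hq]
      have : 1 / (2 * (twoStar - 1)) * (2 * twoStar - 2) = 1 := by
        have : twoStar - 1 ≠ 0 := by
          have : 0 < twoStar - 1 := by linarith
          exact this.ne'
        field_simp
      rw [this, Real.rpow_one]
    rw [← h1, ← Real.rpow_natCast β 2, ← Real.rpow_add hβ0]
    congr 1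
    push_cast
    ring
  have hθq : 0 ≤ 1 / θ - 1 / q := by
    have := one_div_le_one_div_of_le (by linarith : (0:ℝ) < θ) hθ₂.le
    linarith
  have hθ12 : 1 / θ - 1 / 2 ≤ 0 := by
    have := one_div_le_one_div_of_le (by norm_num : (0:ℝ) < 2) (by linarith : 2 ≤ θ)
    linarith
  have hq12 : 0 ≤ 1 / 2 - 1 / q := by
    have := one_div_le_one_div_of_le (by norm_num : (0:ℝ) < 2) (by linarith : 2 ≤ q)
    linarith
  have hγ' : ∀ s : ℝ, 0 ≤ s → γ s = s ^ (q - 1) := by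
    intro s hs
    rw [hγ]
    split_ifs with h
    · rfl
    · have : s = 0 := le_antisymm (not_lt.mp h) hs
      rw [this, Real.zero_rpow (by linarith)]
  have hint : ∀ t : ℝ, ∫ s in (0:ℝ)..t, s ^ (q - 1) = t ^ q / q := by
    intro t
    rw [integral_rpow (Or.inl (by linarith))]
    rw [sub_add_cancel, Real.zero_rpow (by linarith), sub_zero]
  intro x t
  have hR : (1 / k) * (1 / θ - 1 / 2) * V x * t ^ 2 ≤ 0 := by
    have h1 : 0 ≤ (1 / k) * V x * t ^ 2 := by
      have := hV₀ x
      positivity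
    nlinarith
  rw [hW]
  rcases le_or_gt t 0 with ht | ht
  · have hw0 : ∀ s ≤ 0, w x s = 0 := by
      intro s hs
      have : γ s = 0 := by rw [hγ, if_neg (not_lt.mpr hs)]
      rw [hw, hγbar, if_pos (hs.trans hβ0.le), this, ite_self]
    have : ∫ s in (0 : ℝ)..t, w x s = ∫ s in (0 : ℝ)..t, (0:ℝ) := by
      apply intervalIntegral.integral_congr
      intro s hs
      rw [Set.uIcc_of_ge ht] at hs
      exact hw0 s hs.2
    rw [this, hw0 t ht]
    simpa using hR
  by_cases hc : x ∈ Λ ∨ t ≤ β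
  · have hw1 : ∀ s, 0 ≤ s → s ≤ t → w x s = s ^ (q - 1) := by
      intro s hs hst
      rw [hw, hγbar]
      rcases hc with hc | hc
      · rw [if_pos hc, hγ' s hs]
      · rw [if_pos (hst.trans hc), ite_self, hγ' s hs]
    have : ∫ s in (0 : ℝ)..t, w x s = ∫ s in (0 : ℝ)..t, s ^ (q - 1) := by
      apply intervalIntegral.integral_congr
      intro s hs
      rw [Set.uIcc_of_le ht.le] at hs
      exact hw1 s hs.1 hs.2
    rw [this, hint, hw1 t ht.le le_rfl]
    have h2 : t ^ (q - 1) * t = t ^ q := by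
      rw [Real.rpow_sub_one ht.ne']
      field_simp
    have h3 : 0 ≤ (1 / θ - 1 / q) * t ^ q := mul_nonneg hθq (Real.rpow_nonneg ht.le _)
    have h4 : 1 / θ * t ^ (q - 1) * t - t ^ q / q = (1 / θ - 1 / q) * t ^ q := by
      rw [mul_assoc, h2]; ring
    rw [h4]
    linarith
  · push Not at hc
    obtain ⟨hx, hβt⟩ := hc
    have e1 : Set.EqOn (fun s : ℝ => s ^ (q - 1)) (w x) (Set.uIcc 0 β) := by
      intro s hs
      rw [Set.uIcc_of_le hβ0.le] at hs
      simp only [hw, hγbar, if_neg hx, if_pos hs.2, hγ' s hs.1]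
    have hβ1 : β ^ (q - 1) = α / k * β := by
      rw [Real.rpow_sub_one hβ0.ne', hβq]
      field_simp
    have e2 : Set.EqOn (fun s : ℝ => α / k * s) (w x) (Set.uIcc β t) := by
      intro s hs
      rw [Set.uIcc_of_le hβt.le] at hs
      simp only [hw, hγbar, if_neg hx]
      split_ifs with h
      · have : s = β := le_antisymm h hs.1
        rw [this, hγ' β hβ0.le, hβ1]
      · rfl
    have i1 : IntervalIntegrable (w x) MeasureTheory.volume 0 β :=
      (intervalIntegral.intervalIntegrable_rpow' (by linarith : -1 < q - 1)).congr
        (fun s hs => e1 (Set.uIoc_subset_uIcc hs))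
    have i2 : IntervalIntegrable (w x) MeasureTheory.volume β t :=
      (Continuous.intervalIntegrable (by fun_prop : Continuous fun s : ℝ => α / k * s) β t).congr
        (fun s hs => e2 (Set.uIoc_subset_uIcc hs))
    rw [← intervalIntegral.integral_add_adjacent_intervals i1 i2,
      ← intervalIntegral.integral_congr e1, ← intervalIntegral.integral_congr e2, hint,
      intervalIntegral.integral_const_mul, integral_id, hβq,
      ← e2 Set.right_mem_uIcc]
    have h1 : 0 ≤ α / k * β ^ 2 * (1 / 2 - 1 / q) := by positivity
    have h2 : 0 ≤ (1 / k) * t ^ 2 * ((1 / 2 - 1 / θ) * (V x - α)) := by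
      have := hVα x hx
      have h3 : 0 ≤ (1 / 2 - 1 / θ) * (V x - α) := mul_nonneg (by linarith) (by linarith)
      positivity
    have h5 : 1 / θ * (α / k * t) * t - (α / k * β ^ 2 / q + α / k * ((t ^ 2 - β ^ 2) / 2))
        - (1 / k) * (1 / θ - 1 / 2) * V x * t ^ 2 = α / k * β ^ 2 * (1 / 2 - 1 / q)
        + (1 / k) * t ^ 2 * ((1 / 2 - 1 / θ) * (V x - α)) := by ring
    simp only [] at *
    linarith
end

section
/- Under the same hypotheses (V ≥ 0 on ℝᴺ, V ≥ α off Λ, 4 < θ ≤ 2·2*, k > 0, β = (α/k)^{1/(2(2*−1))}), for every x ∈ ℝᴺ and every t ≥ 0 one has W(x,t) ≤ (1/θ)·t^{2·2*} + (1/(2k))·V(x)·t². -/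
open scoped Classical

/-- Upper bound for the primitive of the truncated nonlinearity: under the standing
assumptions (`V ≥ 0`, `V ≥ α` off `Λ`, `4 < θ ≤ 2·2*`, `k > 0`,
`β = (α/k)^{1/(2(2*−1))}`), for every `x` and `t ≥ 0`,
`W(x,t) ≤ (1/θ)·t^{2·2*} + (1/(2k))·V(x)·t²`. -/
theorem stmt_12 (N : ℕ) (hN : 2 < N) (twoStar q : ℝ)
    (h2s : twoStar = 2 * N / (N - 2)) (hq : q = 2 * twoStar)
    (θ k α β : ℝ) (hθ₁ : 4 < θ) (hθ₂ : θ ≤ q) (hk : 0 < k) (hα : 0 < α)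
    (hβ : β = (α / k) ^ (1 / (2 * (twoStar - 1))))
    (Λ : Set (EuclideanSpace ℝ (Fin N)))
    (V : EuclideanSpace ℝ (Fin N) → ℝ) (hV₀ : ∀ x, 0 ≤ V x)
    (hVα : ∀ x, x ∉ Λ → α ≤ V x)
    (γ : ℝ → ℝ) (hγ : ∀ s : ℝ, γ s = if 0 < s then s ^ (q - 1) else 0)
    (γbar : ℝ → ℝ) (hγbar : ∀ s : ℝ, γbar s = if s ≤ β then γ s else (α / k) * s)
    (w : EuclideanSpace ℝ (Fin N) → ℝ → ℝ)
    (hw : ∀ x s, w x s = if x ∈ Λ then γ s else γbar s)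
    (W : EuclideanSpace ℝ (Fin N) → ℝ → ℝ)
    (hW : ∀ x t, W x t = ∫ s in (0 : ℝ)..t, w x s) :
    ∀ (x : EuclideanSpace ℝ (Fin N)) (t : ℝ), 0 ≤ t →
      W x t ≤ (1 / θ) * t ^ q + (1 / (2 * k)) * V x * t ^ 2 := by
  intro x t ht
  have hθ : 0 < θ := by linarith
  have hq0 : 0 < q := by linarith
  have hV := hV₀ x
  have htq : 0 ≤ t ^ q := Real.rpow_nonneg ht q
  rw [hW]
  by_cases hi : IntervalIntegrable (w x) MeasureTheory.volume 0 t
  · have i1 : IntervalIntegrable (fun s : ℝ => s ^ (q - 1)) MeasureTheory.volume 0 t :=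
      intervalIntegral.intervalIntegrable_rpow' (by linarith)
    have i2 : IntervalIntegrable (fun s : ℝ => V x / k * s) MeasureTheory.volume 0 t :=
      (by fun_prop : Continuous (fun s : ℝ => V x / k * s)).intervalIntegrable _ _
    have hpt : ∀ s ∈ Set.Icc (0 : ℝ) t, w x s ≤ s ^ (q - 1) + V x / k * s := by
      intro s hs
      have hs0 : 0 ≤ s := hs.1
      have h1 : 0 ≤ s ^ (q - 1) := Real.rpow_nonneg hs0 _
      have h2 : 0 ≤ V x / k * s := by positivity
      have hg : γ s ≤ s ^ (q - 1) := by
        rw [hγ]; split_ifs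
        · exact le_refl _
        · exact h1
      rw [hw]
      split_ifs with hx
      · linarith
      · rw [hγbar]
        split_ifs
        · linarith
        · have h3 : α / k * s ≤ V x / k * s := by
            have := hVα x hx
            gcongr
          linarith
    have hle := intervalIntegral.integral_mono_on ht hi (i1.add i2) hpt
    have heq : ∫ s in (0 : ℝ)..t, (s ^ (q - 1) + V x / k * s)
        = t ^ q / q + V x / k * (t ^ 2 / 2) := by
      rw [intervalIntegral.integral_add i1 i2, integral_rpow (Or.inl (by linarith)),
        intervalIntegral.integral_const_mul, integral_id]
      simp [Real.zero_rpow hq0.ne']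
    have h4 : t ^ q / q ≤ t ^ q / θ := div_le_div_of_nonneg_left htq hθ hθ₂
    have h5 : (1 / θ) * t ^ q + (1 / (2 * k)) * V x * t ^ 2
        = t ^ q / θ + V x / k * (t ^ 2 / 2) := by
      field_simp
    have h6 : ∫ s in (0 : ℝ)..t, w x s ≤ t ^ q / q + V x / k * (t ^ 2 / 2) := heq ▸ hle
    rw [h5]; linarith
  · rw [intervalIntegral.integral_undef hi]
    positivity
end

section
/- Let N > 2 and 2* = 2N/(N−2). There is a constant C > 0 depending only on N such that for every continuously differentiable function v : ℝᴺ → ℝ with compact support, ∫_{ℝᴺ} |f(v(x))|^{2·2*} dx ≤ C · ( ∫_{ℝᴺ} |∇v(x)|² dx )^{2*/2}. (Proof: z = f(v)|f(v)| satisfies |∇z|² = 4 f(v)²/(1+f(v)²) · |∇v|² ≤ 4|∇v|² pointwise, and one applies the Sobolev inequality ∫|z|^{2*} ≤ C(∫|∇z|²)^{2*/2} to z.) -/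
open MeasureTheory

lemma h_lower (u : ℝ) : u ^ 2 ≤ 2 * |h u| := by
  have hs : |u| ≤ Real.sqrt (1 + u^2) := by
    rw [← Real.sqrt_sq_eq_abs]
    exact Real.sqrt_le_sqrt (by linarith)
  have hh : h u = (1/2) * u * Real.sqrt (1 + u^2) + (1/2) * Real.arsinh u := rfl
  rw [hh]
  rcases le_total 0 u with hu | hu
  · have h1 : 0 ≤ Real.arsinh u := Real.arsinh_nonneg_iff.2 hu
    rw [abs_of_nonneg hu] at hs
    have := le_abs_self ((1/2) * u * Real.sqrt (1 + u^2) + (1/2) * Real.arsinh u)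
    nlinarith
  · have h1 : Real.arsinh u ≤ 0 := Real.arsinh_nonpos_iff.2 hu
    rw [abs_of_nonpos hu] at hs
    have := neg_abs_le ((1/2) * u * Real.sqrt (1 + u^2) + (1/2) * Real.arsinh u)
    nlinarith

/-- With `f` the inverse of `h`, `N > 2` and `2* = 2N/(N−2)`: there is `C > 0`
(depending only on `N`) such that for every `C¹` compactly supported `v : ℝᴺ → ℝ`,
`∫ |f(v)|^{2·2*} ≤ C (∫ |∇v|²)^{2*/2}`. -/
theorem stmt_13 (N : ℕ) (hN : 2 < N) (twoStar : ℝ) (h2s : twoStar = 2 * N / (N - 2))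
    (f : ℝ → ℝ) (hf₁ : Function.LeftInverse f h) (hf₂ : Function.RightInverse f h) :
    ∃ C : ℝ, 0 < C ∧
      ∀ v : EuclideanSpace ℝ (Fin N) → ℝ, ContDiff ℝ 1 v → HasCompactSupport v →
        ∫ x, |f (v x)| ^ (2 * twoStar) ≤
          C * (∫ x, ‖fderiv ℝ v x‖ ^ 2) ^ (twoStar / 2) := by
  have hN' : (2:ℝ) < N := by exact_mod_cast hN
  have hN2 : (0:ℝ) < (N:ℝ) - 2 := by linarith
  have hpos : 0 < twoStar := by rw [h2s]; positivity
  set K : NNReal := eLpNormLESNormFDerivOfEqInnerConst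
    (volume : Measure (EuclideanSpace ℝ (Fin N))) ((2 : NNReal) : ℝ) with hK
  refine ⟨2 ^ twoStar * ((K:ℝ) + 1) ^ twoStar, by positivity, fun v hv hc => ?_⟩
  let q : NNReal := ⟨twoStar, hpos.le⟩
  have hq0 : q ≠ 0 := fun h0 => hpos.ne' (congrArg NNReal.toReal h0)
  have hqr : ((q : ENNReal)).toReal = twoStar := rfl
  have sob := eLpNorm_le_eLpNorm_fderiv_of_eq_inner
    (volume : Measure (EuclideanSpace ℝ (Fin N))) hv hc (p := 2) (p' := q)
    (by norm_num) (by simp; omega) (by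
      change twoStar⁻¹ = _
      rw [h2s]; simp; field_simp)
  have hv1 : MemLp v q := hv.continuous.memLp_of_hasCompactSupport hc
  have hv2 : MemLp (fderiv ℝ v) ((2 : NNReal) : ENNReal) :=
    (hv.continuous_fderiv (by norm_num)).memLp_of_hasCompactSupport (hc.fderiv ℝ)
  rw [← hK, hv1.eLpNorm_eq_integral_rpow_norm (by simpa using hq0) (by simp),
    hv2.eLpNorm_eq_integral_rpow_norm (by simp) (by simp), hqr,
    ← ENNReal.ofReal_coe_nnreal, ← ENNReal.ofReal_mul (by positivity),
    ENNReal.ofReal_le_ofReal_iff (by positivity)] at sob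
  simp only [ENNReal.coe_toReal, NNReal.coe_ofNat, Real.rpow_ofNat] at sob
  set I := ∫ x, ‖fderiv ℝ v x‖ ^ 2 with hI
  have hI0 : 0 ≤ I := integral_nonneg fun x => by positivity
  have hJ0 : 0 ≤ ∫ x, ‖v x‖ ^ twoStar := integral_nonneg fun x => by positivity
  have hint : Integrable (fun x => ‖v x‖ ^ twoStar) := by
    have := hv1.integrable_norm_rpow (by simpa using hq0) (by simp)
    simpa [hqr] using this
  have sob2 : ∫ x, ‖v x‖ ^ twoStar ≤ ((K:ℝ) + 1) ^ twoStar * I ^ (twoStar / 2) := by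
    have h1 := Real.rpow_le_rpow (by positivity) sob hpos.le
    rw [← Real.rpow_mul hJ0, inv_mul_cancel₀ hpos.ne', Real.rpow_one,
      Real.mul_rpow (by positivity) (by positivity), ← Real.rpow_mul hI0] at h1
    have e : (2:ℝ)⁻¹ * twoStar = twoStar / 2 := by ring
    rw [e] at h1
    refine h1.trans ?_
    gcongr
    linarith
  have hpt : ∀ x, |f (v x)| ^ (2 * twoStar) ≤ 2 ^ twoStar * ‖v x‖ ^ twoStar := by
    intro x
    rw [Real.rpow_mul (abs_nonneg _), Real.rpow_two, sq_abs,
      ← Real.mul_rpow (by norm_num) (norm_nonneg _)]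
    refine Real.rpow_le_rpow (sq_nonneg _) ?_ hpos.le
    have := h_lower (f (v x))
    rwa [hf₂ (v x)] at this
  calc ∫ x, |f (v x)| ^ (2 * twoStar) ≤ ∫ x, 2 ^ twoStar * ‖v x‖ ^ twoStar :=
        integral_mono_of_nonneg (Filter.Eventually.of_forall fun x => by positivity)
          (hint.const_mul _) (Filter.Eventually.of_forall hpt)
    _ = 2 ^ twoStar * ∫ x, ‖v x‖ ^ twoStar := integral_const_mul _ _
    _ ≤ 2 ^ twoStar * (((K:ℝ) + 1) ^ twoStar * I ^ (twoStar / 2)) := by gcongr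
    _ = _ := by ring
end
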